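/- For a q-matroid M=(E,ρ) and any subspace V ≤ E, the cyclic core cyc(V) equals the sum of all circuits of M contained in V. Consequently cyc(V) is the largest open space contained in V, and V is independent if and only if cyc(V) = 0. -/

import Mathlib

open Submodule Module

namespace QM

variable (F : Type*) {E : Type*} [Field F] [AddCommGroup E] [Module F E]

/-- The rank axioms (R1)-(R3) of a q-matroid. -/
def IsRkFn (ρ : Submodule F E → ℕ) : Prop :=
  (∀ V : Submodule F E, ρ V ≤ finrank F V) ∧
  (∀ ⦃V W : Submodule F E⦄, V ≤ W → ρ V ≤ ρ W) ∧
  (∀ V W : Submodule F E, ρ (V ⊔ W) + ρ (V ⊓ W) ≤ ρ V + ρ W)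

variable {F}

/-- Independent spaces. -/
def Indep (ρ : Submodule F E → ℕ) (V : Submodule F E) : Prop := ρ V = finrank F V

/-- Circuits: dependent spaces all of whose proper subspaces are independent. -/
def IsCircuit (ρ : Submodule F E → ℕ) (C : Submodule F E) : Prop :=
  ¬ Indep ρ C ∧ ∀ D : Submodule F E, D < C → Indep ρ D

/-- Open spaces: sums of circuits. -/
def IsOpenSp (ρ : Submodule F E → ℕ) (V : Submodule F E) : Prop :=
  ∃ S : Set (Submodule F E), (∀ C ∈ S, IsCircuit ρ C) ∧ V = sSup S

/-- The cyclic core: the sum of all circuits contained in `V`. -/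
def cyc (ρ : Submodule F E → ℕ) (V : Submodule F E) : Submodule F E :=
  sSup {C : Submodule F E | IsCircuit ρ C ∧ C ≤ V}

/-- The closure operator: the sum of all `⟨x⟩` with `ρ(V + ⟨x⟩) = ρ V`. -/
def cl (ρ : Submodule F E → ℕ) (V : Submodule F E) : Submodule F E :=
  sSup {W : Submodule F E | ∃ x : E, ρ (V ⊔ span F {x}) = ρ V ∧ W = span F {x}}

/-- Flats. -/
def IsFlat (ρ : Submodule F E → ℕ) (V : Submodule F E) : Prop :=
  ∀ x : E, x ∉ V → ρ V < ρ (V ⊔ span F {x})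

/-- Cyclic flats. -/
def CyclicFlat (ρ : Submodule F E → ℕ) (V : Submodule F E) : Prop :=
  IsFlat ρ V ∧ IsOpenSp ρ V

end QM

namespace QM

section Helpers

variable {F E : Type*} [Field F] [AddCommGroup E] [Module F E]

theorem indep_mono {ρ : Submodule F E → ℕ} (hρ : IsRkFn F ρ) [FiniteDimensional F E]
    {I J : Submodule F E} (hI : Indep ρ I) (hJ : J ≤ I) : Indep ρ J := by
  obtain ⟨h1, h2, h3⟩ := hρ
  obtain ⟨D, hD⟩ := Submodule.exists_isCompl J
  have hs : J ⊔ (D ⊓ I) = I := by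
    rw [← sup_inf_assoc_of_le D hJ, hD.sup_eq_top, top_inf_eq]
  have hi : J ⊓ (D ⊓ I) = ⊥ := by
    rw [← inf_assoc, hD.inf_eq_bot, bot_inf_eq]
  have hd := finrank_sup_add_finrank_inf_eq J (D ⊓ I)
  rw [hs, hi, finrank_bot] at hd
  have h4 := h3 J (D ⊓ I)
  rw [hs] at h4
  have h5 := h1 J
  have h6 := h1 (D ⊓ I)
  unfold Indep at *
  omega

theorem exists_circuit {ρ : Submodule F E → ℕ} [FiniteDimensional F E]
    {V : Submodule F E} (hV : ¬ Indep ρ V) : ∃ C, IsCircuit ρ C ∧ C ≤ V := by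
  induction V using WellFoundedLT.induction with
  | ind V ih =>
    by_cases h : ∀ D : Submodule F E, D < V → Indep ρ D
    · exact ⟨V, ⟨hV, h⟩, le_rfl⟩
    · push Not at h
      obtain ⟨D, hD, hn⟩ := h
      obtain ⟨C, hC, hle⟩ := ih D hD hn
      exact ⟨C, hC, hle.trans hD.le⟩

theorem finrank_sup_le [FiniteDimensional F E] (W : Submodule F E) (x : E) :
    finrank F ↥(W ⊔ span F {x}) ≤ finrank F W + 1 := by
  have h := finrank_sup_add_finrank_inf_eq W (span F {x})
  have h2 : finrank F (span F {x}) ≤ 1 := by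
    simpa using finrank_span_le_card (R := F) ({x} : Set E)
  omega

theorem exists_max [FiniteDimensional F E] (P : Submodule F E → Prop) {I : Submodule F E}
    (hI : P I) : ∃ J, P J ∧ ∀ K, P K → ¬ J < K := by
  obtain ⟨m, hm, h⟩ := (wellFounded_gt (α := Submodule F E)).has_min {J | P J} ⟨I, hI⟩
  exact ⟨m, hm, fun K hK => h K hK⟩

theorem lt_sup_span {W : Submodule F E} {y : E} (hy : y ∉ W) : W < W ⊔ span F {y} := by
  refine lt_of_le_of_ne le_sup_left fun h => hy ?_
  rw [h]
  exact (le_sup_right : span F {y} ≤ _) (mem_span_singleton_self y)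

theorem exists_basis {ρ : Submodule F E → ℕ} (hρ : IsRkFn F ρ) [FiniteDimensional F E]
    (H : Submodule F E) : ∃ I, I ≤ H ∧ Indep ρ I ∧ ρ I = ρ H := by
  obtain ⟨h1, h2, h3⟩ := hρ
  have hb : Indep ρ (⊥ : Submodule F E) := by
    have := h1 ⊥
    unfold Indep
    rw [finrank_bot] at *
    omega
  obtain ⟨I, ⟨hIH, hI⟩, hmax⟩ := exists_max (fun I => I ≤ H ∧ Indep ρ I) ⟨bot_le, hb⟩
  refine ⟨I, hIH, hI, ?_⟩
  have key : ∀ y ∈ H, ρ (I ⊔ span F {y}) = ρ I := by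
    intro y hy
    by_cases hyI : y ∈ I
    · rw [sup_eq_left.2 ((span_singleton_le_iff_mem y I).2 hyI)]
    · have hlt := lt_sup_span hyI
      have hle : I ⊔ span F {y} ≤ H := sup_le hIH ((span_singleton_le_iff_mem y H).2 hy)
      have hn : ¬ Indep ρ (I ⊔ span F {y}) := fun h => hmax _ ⟨hle, h⟩ hlt
      have a := finrank_sup_le I y
      have b := h1 (I ⊔ span F {y})
      have c := h2 hlt.le
      unfold Indep at *
      omega
  obtain ⟨J, ⟨hIJ, hJH, hJ⟩, hJmax⟩ :=
    exists_max (fun J => I ≤ J ∧ J ≤ H ∧ ρ J = ρ I) ⟨le_rfl, hIH, rfl⟩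
  by_cases hHJ : H ≤ J
  · rw [← hJ, le_antisymm hJH hHJ]
  · exfalso
    obtain ⟨y, hy, hyJ⟩ := SetLike.not_le_iff_exists.1 hHJ
    have hlt := lt_sup_span hyJ
    refine hJmax _ ⟨hIJ.trans hlt.le, sup_le hJH ((span_singleton_le_iff_mem y H).2 hy), ?_⟩ hlt
    have a := h3 J (I ⊔ span F {y})
    rw [← sup_assoc, sup_eq_left.2 hIJ, key y hy] at a
    have b : ρ I ≤ ρ (J ⊓ (I ⊔ span F {y})) := h2 (le_inf hIJ le_sup_left)
    have c := h2 hlt.le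
    omega

theorem exists_hyper {K V : Submodule F E} (hK : K ≤ V) {x : E} (hxV : x ∈ V) (hx : x ∉ K) :
    ∃ H, K ≤ H ∧ H ≤ V ∧ H ⊔ span F {x} = V ∧ x ∉ H := by
  obtain ⟨D, hD⟩ := Submodule.exists_isCompl (K ⊔ span F {x})
  have hle : K ⊔ span F {x} ≤ V := sup_le hK ((span_singleton_le_iff_mem x V).2 hxV)
  refine ⟨K ⊔ (D ⊓ V), le_sup_left, sup_le hK inf_le_right, ?_, ?_⟩
  · rw [sup_right_comm, ← sup_inf_assoc_of_le D hle, hD.sup_eq_top, top_inf_eq]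
  · intro h
    obtain ⟨k, hk, d, hd, rfl⟩ := mem_sup.1 h
    have hd' : d ∈ K ⊔ span F {k + d} := by
      have a : k + d ∈ K ⊔ span F {k + d} :=
        (le_sup_right : span F {k + d} ≤ _) (mem_span_singleton_self _)
      have b : k ∈ K ⊔ span F {k + d} := (le_sup_left : K ≤ _) hk
      simpa using sub_mem a b
    have h0 : d = 0 := (Submodule.disjoint_def.1 hD.disjoint) d hd' hd.1
    apply hx
    simpa [h0] using hk

end Helpers

variable {F E : Type*} [Field F] [Fintype F] [AddCommGroup E] [Module F E]
  [FiniteDimensional F E]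

theorem stmt2 (ρ : Submodule F E → ℕ) (hρ : IsRkFn F ρ) (V : Submodule F E) :
    ((cyc ρ V : Set E) =
      {x : E | x ∈ V ∧ ∀ W : Submodule F E, W ≤ V → W ⊔ span F {x} = V → ρ W = ρ V}) ∧
    IsOpenSp ρ (cyc ρ V) ∧ cyc ρ V ≤ V ∧
    (∀ O : Submodule F E, IsOpenSp ρ O → O ≤ V → O ≤ cyc ρ V) ∧
    (Indep ρ V ↔ cyc ρ V = ⊥) := by
  have hle : cyc ρ V ≤ V := sSup_le fun C hC => hC.2
  refine ⟨?_, ⟨_, fun C hC => hC.1, rfl⟩, hle, ?_, ?_⟩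
  · ext x
    constructor
    · intro hx
      refine ⟨hle hx, fun W hW hWx => ?_⟩
      by_cases hxW : x ∈ W
      · rw [← hWx, sup_eq_left.2 ((span_singleton_le_iff_mem x W).2 hxW)]
      have hn : ¬ cyc ρ V ≤ W := fun h => hxW (h hx)
      have hC : ∃ C, (IsCircuit ρ C ∧ C ≤ V) ∧ ¬ C ≤ W := by
        by_contra hcon
        push Not at hcon
        exact hn (sSup_le hcon)
      obtain ⟨C, ⟨hC, hCV⟩, hCW⟩ := hC
      have hlt : W < W ⊔ C := left_lt_sup.2 hCW
      have hsV : W ⊔ C ≤ V := sup_le hW hCV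
      have hVd := finrank_sup_le W x
      rw [hWx] at hVd
      have d1 := finrank_lt_finrank_of_lt hlt
      have hsup : W ⊔ C = V :=
        Submodule.eq_of_le_of_finrank_le hsV (by omega)
      have d2 := finrank_sup_add_finrank_inf_eq W C
      have hind : Indep ρ (W ⊓ C) := hC.2 _ (inf_lt_right.2 hCW)
      have hCn := hC.1
      obtain ⟨h1, h2, h3⟩ := hρ
      have s := h3 W C
      have c := h1 C
      have m := h2 hW
      rw [hsup] at d2 s
      unfold Indep at *
      omega
    · rintro ⟨hxV, hx⟩
      by_contra hxK
      obtain ⟨H, hKH, hHV, hHx, hxH⟩ := exists_hyper hle hxV hxK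
      have hr := hx H hHV hHx
      obtain ⟨I, hIH, hI, hIr⟩ := exists_basis hρ H
      have hxI : x ∉ I := fun h => hxH (hIH h)
      have hIV : I ⊔ span F {x} ≤ V :=
        sup_le (hIH.trans hHV) ((span_singleton_le_iff_mem x V).2 hxV)
      have hdep : ¬ Indep ρ (I ⊔ span F {x}) := by
        have a := hρ.2.1 hIV
        have b := finrank_lt_finrank_of_lt (lt_sup_span hxI)
        unfold Indep at *
        omega
      obtain ⟨C, hC, hCI⟩ := exists_circuit hdep
      have hCH : C ≤ H :=
        (le_sSup (show C ∈ {C | IsCircuit ρ C ∧ C ≤ V} from ⟨hC, hCI.trans hIV⟩)).trans hKH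
      have hdis : span F {x} ⊓ H = ⊥ := by
        rw [eq_bot_iff]
        rintro y ⟨hy, hyH⟩
        obtain ⟨c, rfl⟩ := mem_span_singleton.1 hy
        by_cases hc : c = 0
        · simp [hc]
        · exact absurd ((H.smul_mem_iff hc).1 hyH) hxH
      have hCI' : C ≤ I := by
        have := le_inf hCI hCH
        rwa [sup_inf_assoc_of_le _ hIH, hdis, sup_bot_eq] at this
      exact hC.1 (indep_mono hρ hI hCI')
  · rintro O ⟨S, hS, rfl⟩ hO
    exact sSup_le fun C hC => le_sSup ⟨hS C hC, (le_sSup hC).trans hO⟩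
  · constructor
    · intro h
      rw [eq_bot_iff]
      exact sSup_le fun C hC => absurd (indep_mono hρ h hC.2) hC.1.1
    · intro h
      by_contra hV
      obtain ⟨C, hC, hCV⟩ := exists_circuit hV
      have hb : C ≤ ⊥ := h ▸ (le_sSup (show C ∈ {C | IsCircuit ρ C ∧ C ≤ V} from ⟨hC, hCV⟩))
      obtain rfl := le_bot_iff.1 hb
      apply hC.1
      have := hρ.1 ⊥
      unfold Indep
      rw [finrank_bot] at *
      omega

end QM
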